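/- arXiv:math/0308005 — 6 statements merged into one kernel-verified Lean document; each statement's English description precedes it below -/
import Mathlib

section
/- Fix a commutative ring R and an R-module A. Let f be a p-cochain, g a q-cochain and h an r-cochain (p, q, r ≥ 1), and let 1 ≤ i < j ≤ p. Then (f ∘ⱼ h) ∘ᵢ g = (f ∘ᵢ g) ∘_{j+q−1} h as (p+q+r−2)-cochains. -/
/-- Partial (insertion) composition `f ∘ᵢ g` of a `p`-cochain `f` with a `q`-cochain `g`
at the (1-based) slot `i`, producing an `n`-cochain where `n + 1 = p + q`
(i.e. `n = p + q - 1`).  Explicitly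
`(f ∘ᵢ g)(a₁,…,aₙ) = f(a₁,…,a_{i−1}, g(aᵢ,…,a_{i+q−1}), a_{i+q},…,aₙ)`. -/
def pcomp {A : Type*} {p q n : ℕ} (hq : 1 ≤ q) (hn : n + 1 = p + q)
    (f : (Fin p → A) → A) (g : (Fin q → A) → A) (i : ℕ) :
    (Fin n → A) → A := fun a =>
  f fun k =>
    if k.val + 1 < i then a ⟨k.val, by have hk := k.isLt; omega⟩
    else if k.val + 1 = i then
      g fun l => a ⟨k.val + l.val, by have hk := k.isLt; have hl := l.isLt; omega⟩
    else a ⟨k.val + q - 1, by have hk := k.isLt; omega⟩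

/-- Parallel (disjoint-slot) associativity of the partial compositions of
multilinear cochains: for `1 ≤ i < j ≤ p`,
`(f ∘ⱼ h) ∘ᵢ g = (f ∘ᵢ g) ∘_{j+q−1} h` as `(p+q+r−2)`-cochains. -/
theorem pcomp_parallel_assoc {R A : Type*} [CommRing R] [AddCommGroup A] [Module R A]
    {p q r : ℕ} (hp : 1 ≤ p) (hq : 1 ≤ q) (hr : 1 ≤ r)
    (f : MultilinearMap R (fun _ : Fin p => A) A)
    (g : MultilinearMap R (fun _ : Fin q => A) A)
    (h : MultilinearMap R (fun _ : Fin r => A) A)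
    {i j : ℕ} (hi1 : 1 ≤ i) (hij : i < j) (hjp : j ≤ p) :
    pcomp hq (show p + q + r - 2 + 1 = (p + r - 1) + q by omega)
        (pcomp hr (show p + r - 1 + 1 = p + r by omega) (⇑f) (⇑h) j) (⇑g) i
      = pcomp hr (show p + q + r - 2 + 1 = (p + q - 1) + r by omega)
        (pcomp hq (show p + q - 1 + 1 = p + q by omega) (⇑f) (⇑g) i) (⇑h) (j + q - 1) := by
  funext a
  unfold pcomp
  refine congrArg (⇑f) (funext fun k => ?_)
  obtain ⟨k, hk⟩ := k
  dsimp only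
  rcases lt_trichotomy (k + 1) i with h1 | h1 | h1
  · simp only [if_pos h1, if_pos (show k + 1 < j by omega),
      if_pos (show k + 1 < j + q - 1 by omega)]
  · simp only [if_neg (show ¬ k + 1 < i by omega), if_pos h1, if_pos (show k + 1 < j by omega)]
    refine congrArg (⇑g) (funext fun l => ?_)
    rw [if_pos (show k + l.val + 1 < j + q - 1 by have := l.isLt; omega)]
  · simp only [if_neg (show ¬ k + 1 < i by omega), if_neg (show ¬ k + 1 = i by omega)]
    rcases lt_trichotomy (k + 1) j with h2 | h2 | h2
    · simp only [if_pos h2, if_pos (show k + q - 1 + 1 < j + q - 1 by omega)]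
    · simp only [if_neg (show ¬ k + 1 < j by omega), if_pos h2,
        if_neg (show ¬ k + q - 1 + 1 < j + q - 1 by omega),
        if_pos (show k + q - 1 + 1 = j + q - 1 by omega)]
      refine congrArg (⇑h) (funext fun l => ?_)
      rw [if_neg (show ¬ k + l.val + 1 < i by omega), if_neg (show ¬ k + l.val + 1 = i by omega)]
      exact congrArg a (Fin.ext (show k + l.val + q - 1 = k + q - 1 + l.val by omega))
    · simp only [if_neg (show ¬ k + 1 < j by omega), if_neg (show ¬ k + 1 = j by omega),
        if_neg (show ¬ k + q - 1 + 1 < j + q - 1 by omega),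
        if_neg (show ¬ k + q - 1 + 1 = j + q - 1 by omega),
        if_neg (show ¬ k + r - 1 + 1 < i by omega), if_neg (show ¬ k + r - 1 + 1 = i by omega)]
      exact congrArg a (Fin.ext (show k + r - 1 + q - 1 = k + q - 1 + r - 1 by omega))
end

section
/- Fix a commutative ring R and an R-module A. Let f be a p-cochain, g a q-cochain and h an r-cochain, and let ∘ denote the ungraded circle product. Then the pre-Lie identity holds: (f∘g)∘h − f∘(g∘h) = (f∘h)∘g − f∘(h∘g) as (p+q+r−2)-cochains. -/
/-- The ungraded circle (insertion) product of a `p`-cochain `f` and a `q`-cochain `g`: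
`f∘g = Σ_{i=1}^{p} f ∘ᵢ g`, a `(p+q-1)`-cochain. -/
def circ {A : Type*} [AddCommMonoid A] {p q n : ℕ} (hq : 1 ≤ q) (hn : n + 1 = p + q)
    (f : (Fin p → A) → A) (g : (Fin q → A) → A) : (Fin n → A) → A :=
  fun a => ∑ i ∈ Finset.Icc 1 p, pcomp hq hn f g i a

/-- Insertion on sequences. -/
def insSeq {A : Type*} {q : ℕ} (g : (Fin q → A) → A) (i : ℕ) (b : ℕ → A) : ℕ → A := fun k =>
  if k + 1 < i then b k
  else if k + 1 = i then g fun l => b (k + l.val)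
  else b (k + q - 1)

theorem pcomp_eq {A : Type*} {p q n : ℕ} (hq : 1 ≤ q) (hn : n + 1 = p + q)
    (f : (Fin p → A) → A) (g : (Fin q → A) → A) (i : ℕ) (b : ℕ → A) :
    pcomp hq hn f g i (fun k => b k.val) = f (fun k => insSeq g i b k.val) := rfl

theorem insSeq_swap {A : Type*} {q r : ℕ} (hq : 1 ≤ q) (hr : 1 ≤ r) (g : (Fin q → A) → A)
    (h : (Fin r → A) → A) (i j : ℕ) (hi : 1 ≤ i) (hij : i < j) (b : ℕ → A) :
    insSeq g i (insSeq h (j + q - 1) b) = insSeq h j (insSeq g i b) := by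
  funext k
  have e1 : k + 1 = i → (fun l : Fin q => insSeq h (j + q - 1) b (k + l.val))
      = fun l : Fin q => b (k + l.val) := by
    intro hk
    funext l
    have := l.isLt
    simp only [insSeq]
    rw [if_pos (by omega)]
  have e2 : k + 1 = j → (fun l : Fin r => insSeq g i b (k + l.val))
      = fun l : Fin r => b (k + q - 1 + l.val) := by
    intro hk
    funext l
    simp only [insSeq]
    rw [if_neg (by omega), if_neg (by omega)]
    congr 1; omega
  rcases lt_trichotomy (k + 1) i with hk | hk | hk
  · simp only [insSeq]
    rw [if_pos hk, if_pos (by omega), if_pos (by omega), if_pos hk]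
  · rw [insSeq, if_neg (by omega), if_pos hk, e1 hk, insSeq, if_pos (by omega), insSeq,
      if_neg (by omega), if_pos hk]
  · rw [insSeq, if_neg (by omega), if_neg (by omega)]
    rcases lt_trichotomy (k + 1) j with hk2 | hk2 | hk2
    · rw [insSeq, if_pos (by omega), insSeq, if_pos hk2, insSeq, if_neg (by omega),
        if_neg (by omega)]
    · rw [insSeq, if_neg (by omega), if_pos (by omega), insSeq, if_neg (by omega), if_pos hk2,
        e2 hk2]
    · rw [insSeq, if_neg (by omega), if_neg (by omega), insSeq, if_neg (by omega),
        if_neg (by omega), insSeq, if_neg (by omega), if_neg (by omega)]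
      congr 1; omega

theorem insSeq_nest {A : Type*} {q r n : ℕ} (hq : 1 ≤ q) (hr : 1 ≤ r) (hn : n + 1 = q + r)
    (g : (Fin q → A) → A)
    (h : (Fin r → A) → A) (i j : ℕ) (hi : 1 ≤ i) (hj : j < q) (b : ℕ → A) :
    insSeq (pcomp hr hn g h (j + 1)) i b = insSeq g i (insSeq h (j + i) b) := by
  funext k
  rcases lt_trichotomy (k + 1) i with hk | hk | hk
  · rw [insSeq, if_pos hk, insSeq, if_pos hk, insSeq, if_pos (by omega)]
  · rw [insSeq, if_neg (by omega), if_pos hk, insSeq, if_neg (by omega), if_pos hk,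
      pcomp_eq hr hn g h (j + 1) (fun l => b (k + l))]
    congr 1
    funext l
    rcases lt_trichotomy (l.val + 1) (j + 1) with hl | hl | hl
    · rw [insSeq, if_pos hl, insSeq, if_pos (by omega)]
    · rw [insSeq, if_neg (by omega), if_pos hl, insSeq, if_neg (by omega), if_pos (by omega)]
      simp only [add_assoc]
    · rw [insSeq, if_neg (by omega), if_neg (by omega), insSeq, if_neg (by omega),
        if_neg (by omega)]
      congr 1; omega
  · rw [insSeq, if_neg (by omega), if_neg (by omega), insSeq, if_neg (by omega),
      if_neg (by omega), insSeq, if_neg (by omega), if_neg (by omega)]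
    congr 1; omega

theorem insSeq_update {A : Type*} {p n : ℕ} (g g' : (Fin n → A) → A) (i : ℕ) (hi : 1 ≤ i)
    (hip : i - 1 < p) (b : ℕ → A) :
    (fun k : Fin p => insSeq g i b k.val) =
      Function.update (fun k : Fin p => insSeq g' i b k.val) ⟨i - 1, hip⟩
        (g fun l => b (i - 1 + l.val)) := by
  funext k
  by_cases hk : k = ⟨i - 1, hip⟩
  · subst hk
    rw [Function.update_self]
    simp only [insSeq]
    rw [if_neg (by omega), if_pos (by omega)]
  · rw [Function.update_of_ne hk]
    have : k.val + 1 ≠ i := fun h => hk (Fin.ext (by simp; omega))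
    simp only [insSeq, if_neg this]

theorem insSeq_sum {R A : Type*} [CommRing R] [AddCommGroup A] [Module R A]
    {p n : ℕ} (f : MultilinearMap R (fun _ : Fin p => A) A) (s : Finset ℕ)
    (G : ℕ → (Fin n → A) → A) (i : ℕ) (hi : 1 ≤ i) (hip : i ≤ p) (b : ℕ → A) :
    f (fun k => insSeq (fun a => ∑ j ∈ s, G j a) i b k.val)
      = ∑ j ∈ s, f (fun k => insSeq (G j) i b k.val) := by
  have h1 : i - 1 < p := by omega
  rw [insSeq_update _ (G 0) i hi h1, MultilinearMap.map_update_sum]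
  refine Finset.sum_congr rfl fun j _ => ?_
  rw [insSeq_update (G j) (G 0) i hi h1]

theorem assoc_eq {R A : Type*} [CommRing R] [AddCommGroup A] [Module R A]
    {p q r m n N : ℕ} (hq : 1 ≤ q) (hr : 1 ≤ r)
    (f : MultilinearMap R (fun _ : Fin p => A) A)
    (g : (Fin q → A) → A) (h : (Fin r → A) → A)
    (hm : m + 1 = p + q) (hN : N + 1 = m + r) (hn : n + 1 = q + r) (hN' : N + 1 = p + n)
    (hn1 : 1 ≤ n) (b : ℕ → A) :
    circ hr hN (circ hq hm (⇑f) g) h (fun k => b k.val)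
      - circ hn1 hN' (⇑f) (circ hr hn g h) (fun k => b k.val)
    = (∑ i ∈ Finset.Ico 1 (p + 1), ∑ j ∈ Finset.Ico 1 i,
        f (fun k => insSeq g i (insSeq h j b) k.val))
      + ∑ i ∈ Finset.Ico 1 (p + 1), ∑ j ∈ Finset.Ico 1 i,
        f (fun k => insSeq h i (insSeq g j b) k.val) := by
  have h1 : circ hr hN (circ hq hm (⇑f) g) h (fun k => b k.val)
      = ∑ i ∈ Finset.Ico 1 (p + 1), ∑ j ∈ Finset.Ico 1 (p + q),
        f (fun k => insSeq g i (insSeq h j b) k.val) := by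
    rw [Finset.sum_comm, ← hm]
    rfl
  have h2 : circ hn1 hN' (⇑f) (circ hr hn g h) (fun k => b k.val)
      = ∑ i ∈ Finset.Ico 1 (p + 1), ∑ j ∈ Finset.Ico i (q + i),
        f (fun k => insSeq g i (insSeq h j b) k.val) := by
    refine Finset.sum_congr rfl fun i hi => ?_
    rw [Finset.mem_Ico] at hi
    rw [pcomp_eq]
    refine (insSeq_sum f (Finset.Ico 1 (q + 1)) (fun j => pcomp hr hn g h j) i hi.1 (by omega) b).trans ?_
    have e1 := Finset.sum_Ico_add'
      (fun j => f (fun k => insSeq (pcomp hr hn g h j) i b k.val)) 0 q 1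
    have e2 := Finset.sum_Ico_add'
      (fun j => f (fun k => insSeq g i (insSeq h j b) k.val)) 0 q i
    rw [zero_add] at e1 e2
    rw [← e1, ← e2]
    refine Finset.sum_congr rfl fun j hj => ?_
    rw [Finset.mem_Ico] at hj
    rw [insSeq_nest hq hr hn g h i j hi.1 hj.2]
  have h3 : (∑ i ∈ Finset.Ico 1 (p + 1), ∑ j ∈ Finset.Ico 1 i,
        f (fun k => insSeq h i (insSeq g j b) k.val))
      = ∑ i ∈ Finset.Ico 1 (p + 1), ∑ j ∈ Finset.Ico (q + i) (p + q),
        f (fun k => insSeq g i (insSeq h j b) k.val) := by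
    rw [Finset.sum_comm' (t' := Finset.Ico 1 (p + 1)) (s' := fun i => Finset.Ico (i + 1) (p + 1))
      (by intro x y; simp only [Finset.mem_Ico]; omega)]
    refine Finset.sum_congr rfl fun i hi => ?_
    rw [Finset.mem_Ico] at hi
    have e := Finset.sum_Ico_add'
      (fun j => f (fun k => insSeq g i (insSeq h j b) k.val)) (i + 1) (p + 1) (q - 1)
    rw [show i + 1 + (q - 1) = q + i by omega, show p + 1 + (q - 1) = p + q by omega] at e
    rw [← e]
    refine Finset.sum_congr rfl fun j hj => ?_
    rw [Finset.mem_Ico] at hj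
    rw [← insSeq_swap hq hr g h i j hi.1 (by omega) b, Nat.add_sub_assoc hq]
  rw [h1, h2, h3, sub_eq_iff_eq_add, ← Finset.sum_add_distrib, ← Finset.sum_add_distrib]
  refine Finset.sum_congr rfl fun i hi => ?_
  rw [Finset.mem_Ico] at hi
  rw [← Finset.sum_Ico_consecutive _ (show 1 ≤ i by omega) (show i ≤ p + q by omega),
    ← Finset.sum_Ico_consecutive _ (show i ≤ q + i by omega) (show q + i ≤ p + q by omega)]
  abel

/-- The ungraded circle product on multilinear cochains satisfies the
(ungraded, right) pre-Lie identity: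
`(f∘g)∘h − f∘(g∘h) = (f∘h)∘g − f∘(h∘g)` as `(p+q+r−2)`-cochains. -/
theorem circ_preLie {R A : Type*} [CommRing R] [AddCommGroup A] [Module R A]
    {p q r : ℕ} (hp : 1 ≤ p) (hq : 1 ≤ q) (hr : 1 ≤ r)
    (f : MultilinearMap R (fun _ : Fin p => A) A)
    (g : MultilinearMap R (fun _ : Fin q => A) A)
    (h : MultilinearMap R (fun _ : Fin r => A) A) :
    circ hr (show p + q + r - 2 + 1 = (p + q - 1) + r by omega)
        (circ hq (show p + q - 1 + 1 = p + q by omega) (⇑f) (⇑g)) (⇑h)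
      - circ (show 1 ≤ q + r - 1 by omega)
        (show p + q + r - 2 + 1 = p + (q + r - 1) by omega)
        (⇑f) (circ hr (show q + r - 1 + 1 = q + r by omega) (⇑g) (⇑h))
    = circ hq (show p + q + r - 2 + 1 = (p + r - 1) + q by omega)
        (circ hr (show p + r - 1 + 1 = p + r by omega) (⇑f) (⇑h)) (⇑g)
      - circ (show 1 ≤ r + q - 1 by omega)
        (show p + q + r - 2 + 1 = p + (r + q - 1) by omega)
        (⇑f) (circ hq (show r + q - 1 + 1 = r + q by omega) (⇑h) (⇑g)) := by
  funext a
  obtain ⟨b, rfl⟩ : ∃ b : ℕ → A, a = fun k => b k.val :=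
    ⟨fun k => if hk : k < p + q + r - 2 then a ⟨k, hk⟩ else 0, by
      funext k
      simp⟩
  rw [Pi.sub_apply, Pi.sub_apply, assoc_eq hq hr, assoc_eq hr hq, add_comm]
end

section
/- Fix a commutative ring R and an R-module A. Let f be a p-cochain, g a q-cochain and h an r-cochain, and let ∘ denote the graded circle product. Then the graded pre-Lie identity of Gerstenhaber holds: (f∘g)∘h − f∘(g∘h) = (−1)^{(q−1)(r−1)} ((f∘h)∘g − f∘(h∘g)) as (p+q+r−2)-cochains. -/
/-- The graded circle (insertion) product of a `p`-cochain `f` and a `q`-cochain `g`: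
`f∘g = Σ_{i=1}^{p} (−1)^{(i−1)(q+1)} f ∘ᵢ g`, a `(p+q-1)`-cochain. -/
def gcirc {A : Type*} [AddCommGroup A] {p q n : ℕ} (hq : 1 ≤ q) (hn : n + 1 = p + q)
    (f : (Fin p → A) → A) (g : (Fin q → A) → A) : (Fin n → A) → A :=
  fun a => ∑ i ∈ Finset.Icc 1 p, ((-1 : ℤ) ^ ((i - 1) * (q + 1))) • pcomp hq hn f g i a

theorem aux_ext {A : Type*} [AddCommGroup A] {n : ℕ} (a : Fin n → A) :
    ∃ b : ℕ → A, a = fun x => b x.val :=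
  ⟨fun x => if h : x < n then a ⟨x, h⟩ else 0, by funext x; simp⟩

theorem pcomp_par {A : Type*} [AddCommGroup A] {p q r n m m' : ℕ} (hq : 1 ≤ q) (hr : 1 ≤ r)
    (h1 : m + 1 = p + q) (h2 : n + 1 = m + r) (h3 : m' + 1 = p + r) (h4 : n + 1 = m' + q)
    (f : (Fin p → A) → A) (g : (Fin q → A) → A) (h : (Fin r → A) → A)
    (i j : ℕ) (hj : 1 ≤ j) (hij : j < i) (a : Fin n → A) :
    pcomp hr h2 (pcomp hq h1 f g i) h j a
      = pcomp hq h4 (pcomp hr h3 f h j) g (i + r - 1) a := by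
  obtain ⟨b, rfl⟩ := aux_ext a
  simp only [pcomp]
  congr 1
  funext k
  rcases lt_trichotomy (k.val + 1) j with c | c | c
  · simp (disch := omega) only [if_pos, if_neg]
  · simp (disch := omega) only [if_pos, if_neg]
  · rcases lt_trichotomy (k.val + 1) i with d | d | d
    · simp (disch := omega) only [if_pos, if_neg]
    · simp (disch := omega) only [if_pos, if_neg]
      congr 1; funext l
      congr 1; omega
    · simp (disch := omega) only [if_pos, if_neg]
      congr 1; omega

theorem pcomp_seq {A : Type*} [AddCommGroup A] {p q r n m m' : ℕ} (hq : 1 ≤ q) (hr : 1 ≤ r)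
    (hm' : 1 ≤ m')
    (h1 : m + 1 = p + q) (h2 : n + 1 = m + r) (h3 : m' + 1 = q + r) (h4 : n + 1 = p + m')
    (f : (Fin p → A) → A) (g : (Fin q → A) → A) (h : (Fin r → A) → A)
    (i j : ℕ) (hi : 1 ≤ i) (hj : 1 ≤ j) (hij : j ≤ q) (a : Fin n → A) :
    pcomp hr h2 (pcomp hq h1 f g i) h (i + j - 1) a
      = pcomp hm' h4 f (pcomp hr h3 g h j) i a := by
  obtain ⟨b, rfl⟩ := aux_ext a
  simp only [pcomp]
  congr 1
  funext k
  rcases lt_trichotomy (k.val + 1) i with c | c | c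
  · simp (disch := omega) only [if_pos, if_neg]
  · simp (disch := omega) only [if_pos, if_neg]
    congr 1; funext l
    rcases lt_trichotomy (l.val + 1) j with d | d | d
    · simp (disch := omega) only [if_pos, if_neg]
    · simp (disch := omega) only [if_pos, if_neg]
      congr 1; funext l
      congr 1; omega
    · simp (disch := omega) only [if_pos, if_neg]
      congr 1; omega
  · simp (disch := omega) only [if_pos, if_neg]
    congr 1; omega

theorem pcomp_gcirc {R A : Type*} [CommRing R] [AddCommGroup A] [Module R A]
    {p q r n m : ℕ} (hr : 1 ≤ r) (hm : 1 ≤ m)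
    (h3 : m + 1 = q + r) (h4 : n + 1 = p + m)
    (f : MultilinearMap R (fun _ : Fin p => A) A) (g : (Fin q → A) → A) (h : (Fin r → A) → A)
    (i : ℕ) (hi : 1 ≤ i) (hip : i ≤ p) (a : Fin n → A) :
    pcomp hm h4 f (gcirc hr h3 g h) i a
      = ∑ j ∈ Finset.Icc 1 q, ((-1 : ℤ) ^ ((j - 1) * (r + 1))) •
          pcomp hm h4 f (pcomp hr h3 g h j) i a := by
  obtain ⟨b, rfl⟩ := aux_ext a
  have key : ∀ G : (Fin m → A) → A, pcomp hm h4 f G i (fun x => b x.val)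
      = f.toLinearMap (fun k => if k.val + 1 < i then b k.val else b (k.val + m - 1))
          ⟨i - 1, by omega⟩ (G fun l => b (i - 1 + l.val)) := by
    intro G
    simp only [pcomp, MultilinearMap.toLinearMap_apply]
    congr 1
    funext k
    by_cases hk : k = ⟨i - 1, by omega⟩
    · subst hk
      rw [Function.update_self]
      simp (disch := omega) only [if_pos, if_neg]
    · rw [Function.update_of_ne hk]
      have : k.val + 1 ≠ i := fun e => hk (Fin.ext (by simp only []; omega))
      simp only [if_neg this]
  simp only [key]
  rw [gcirc, map_sum]
  simp only [map_zsmul]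

theorem sum_split {A : Type*} [AddCommGroup A] {p q i : ℕ} (hq : 1 ≤ q) (hi : 1 ≤ i) (hip : i ≤ p)
    (F : ℕ → A) : ∑ j ∈ Finset.Icc 1 (p + q - 1), F j
      = ∑ m ∈ Finset.Icc 1 q, F (i + m - 1)
        + (∑ j ∈ Finset.Ico 1 i, F j + ∑ k ∈ Finset.Ioc i p, F (k + q - 1)) := by
  have e1 : ∑ m ∈ Finset.Icc 1 q, F (i + m - 1) = ∑ j ∈ Finset.Ico i (i + q), F j := by
    refine Finset.sum_bij' (fun m _ => i + m - 1) (fun j _ => j - i + 1) ?_ ?_ ?_ ?_ ?_ <;>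
      (intro x hx; simp only [Finset.mem_Icc, Finset.mem_Ico] at *; try omega)
  have e2 : ∑ k ∈ Finset.Ioc i p, F (k + q - 1) = ∑ j ∈ Finset.Ico (i + q) (p + q), F j := by
    refine Finset.sum_bij' (fun m _ => m + q - 1) (fun j _ => j + 1 - q) ?_ ?_ ?_ ?_ ?_ <;>
      (intro x hx; simp only [Finset.mem_Ioc, Finset.mem_Ico] at *; try omega)
  have e3 : Finset.Icc 1 (p + q - 1) = Finset.Ico 1 (p + q) := by
    ext x; simp only [Finset.mem_Icc, Finset.mem_Ico]; omega
  rw [e1, e2, e3, ← Finset.sum_Ico_consecutive F (show 1 ≤ i + q by omega) (by omega : i + q ≤ p + q),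
    ← Finset.sum_Ico_consecutive F hi (show i ≤ i + q by omega)]
  abel

theorem neg_pow_congr {x y : ℕ} (h : x % 2 = y % 2) : (-1 : ℤ) ^ x = (-1) ^ y := by
  rw [neg_one_pow_eq_pow_mod_two, h, ← neg_one_pow_eq_pow_mod_two]

theorem assoc_expand {R A : Type*} [CommRing R] [AddCommGroup A] [Module R A]
    {p q r n m m' : ℕ} (hq : 1 ≤ q) (hr : 1 ≤ r) (hm' : 1 ≤ m')
    (h1 : m + 1 = p + q) (h2 : n + 1 = m + r) (h3 : m' + 1 = q + r) (h4 : n + 1 = p + m')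
    (f : MultilinearMap R (fun _ : Fin p => A) A) (g : (Fin q → A) → A) (h : (Fin r → A) → A)
    (a : Fin n → A) :
    gcirc hr h2 (gcirc hq h1 f g) h a - gcirc hm' h4 f (gcirc hr h3 g h) a
      = ∑ i ∈ Finset.Icc 1 p, ∑ j ∈ Finset.Ico 1 i,
          ((-1 : ℤ) ^ ((j - 1) * (r + 1) + (i - 1) * (q + 1))) •
            pcomp hr h2 (pcomp hq h1 f g i) h j a
        + ∑ i ∈ Finset.Icc 1 p, ∑ k ∈ Finset.Ioc i p,
          ((-1 : ℤ) ^ ((k + q - 1 - 1) * (r + 1) + (i - 1) * (q + 1))) •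
            pcomp hr h2 (pcomp hq h1 f g i) h (k + q - 1) a := by
  have L : gcirc hr h2 (gcirc hq h1 f g) h a = ∑ i ∈ Finset.Icc 1 p, ∑ j ∈ Finset.Icc 1 m,
      ((-1 : ℤ) ^ ((j - 1) * (r + 1) + (i - 1) * (q + 1))) •
            pcomp hr h2 (pcomp hq h1 f g i) h j a := by
    rw [Finset.sum_comm, gcirc]
    refine Finset.sum_congr rfl fun j _ => ?_
    simp only [pow_add, mul_smul, ← Finset.smul_sum]
    rfl
  have M : gcirc hm' h4 f (gcirc hr h3 g h) a = ∑ i ∈ Finset.Icc 1 p, ∑ j ∈ Finset.Icc 1 q,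
      ((-1 : ℤ) ^ ((i + j - 1 - 1) * (r + 1) + (i - 1) * (q + 1))) •
            pcomp hr h2 (pcomp hq h1 f g i) h (i + j - 1) a := by
    rw [gcirc]
    refine Finset.sum_congr rfl fun i hi => ?_
    rw [Finset.mem_Icc] at hi
    rw [pcomp_gcirc hr hm' h3 h4 f g h i hi.1 hi.2 a, Finset.smul_sum]
    refine Finset.sum_congr rfl fun j hj => ?_
    rw [Finset.mem_Icc] at hj
    rw [pcomp_seq hq hr hm' h1 h2 h3 h4 f g h i j hi.1 hj.1 hj.2 a, smul_smul, ← pow_add]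
    congr 1
    apply neg_pow_congr
    obtain ⟨i, rfl⟩ := Nat.exists_eq_add_of_le' hi.1
    obtain ⟨j, rfl⟩ := Nat.exists_eq_add_of_le' hj.1
    rw [h3, show i + 1 + (j + 1) - 1 - 1 = i + j by omega, Nat.add_sub_cancel, Nat.add_sub_cancel,
      show (i + j) * (r + 1) + i * (q + 1) = i * (q + r) + j * (r + 1) + 2 * i by ring]
    omega
  obtain rfl : m = p + q - 1 := by omega
  rw [L, M, ← Finset.sum_sub_distrib, ← Finset.sum_add_distrib]
  refine Finset.sum_congr rfl fun i hi => ?_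
  rw [Finset.mem_Icc] at hi
  rw [sum_split hq hi.1 hi.2, add_sub_cancel_left]

theorem cross {A : Type*} [AddCommGroup A]
    {p q r n m m' : ℕ} (hq : 1 ≤ q) (hr : 1 ≤ r)
    (h1 : m + 1 = p + q) (h2 : n + 1 = m + r) (h3 : m' + 1 = p + r) (h4 : n + 1 = m' + q)
    (f : (Fin p → A) → A) (g : (Fin q → A) → A) (h : (Fin r → A) → A)
    (a : Fin n → A) :
    ∑ i ∈ Finset.Icc 1 p, ∑ j ∈ Finset.Ico 1 i,
          ((-1 : ℤ) ^ ((j - 1) * (r + 1) + (i - 1) * (q + 1))) •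
            pcomp hr h2 (pcomp hq h1 f g i) h j a
      = ((-1 : ℤ) ^ ((q - 1) * (r - 1))) • ∑ i ∈ Finset.Icc 1 p, ∑ k ∈ Finset.Ioc i p,
          ((-1 : ℤ) ^ ((k + r - 1 - 1) * (q + 1) + (i - 1) * (r + 1))) •
            pcomp hq h4 (pcomp hr h3 f h i) g (k + r - 1) a := by
  rw [Finset.sum_comm' (t' := Finset.Icc 1 p) (s' := fun j => Finset.Ioc j p)
    (by intro x y; simp only [Finset.mem_Icc, Finset.mem_Ico, Finset.mem_Ioc]; omega)]
  rw [Finset.smul_sum]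
  refine Finset.sum_congr rfl fun j hj => ?_
  rw [Finset.smul_sum]
  refine Finset.sum_congr rfl fun i hi => ?_
  rw [Finset.mem_Icc] at hj
  rw [Finset.mem_Ioc] at hi
  rw [pcomp_par hq hr h1 h2 h3 h4 f g h i j hj.1 hi.1 a, smul_smul, ← pow_add]
  congr 1
  apply neg_pow_congr
  obtain ⟨i, rfl⟩ := Nat.exists_eq_add_of_le' (show 1 ≤ i by omega)
  obtain ⟨q, rfl⟩ := Nat.exists_eq_add_of_le' hq
  obtain ⟨r, rfl⟩ := Nat.exists_eq_add_of_le' hr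
  rw [show i + 1 + (r + 1) - 1 - 1 = i + r by omega]
  simp only [Nat.add_sub_cancel]
  rw [show q * r + ((i + r) * (q + 1 + 1) + (j - 1) * (r + 1 + 1))
    = (j - 1) * (r + 1 + 1) + i * (q + 1 + 1) + 2 * (q * r + r) by ring]
  omega

/-- Gerstenhaber's graded pre-Lie identity for the graded circle product:
`(f∘g)∘h − f∘(g∘h) = (−1)^{(q−1)(r−1)} ((f∘h)∘g − f∘(h∘g))` as `(p+q+r−2)`-cochains. -/
theorem gcirc_graded_preLie {R A : Type*} [CommRing R] [AddCommGroup A] [Module R A]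
    {p q r : ℕ} (hp : 1 ≤ p) (hq : 1 ≤ q) (hr : 1 ≤ r)
    (f : MultilinearMap R (fun _ : Fin p => A) A)
    (g : MultilinearMap R (fun _ : Fin q => A) A)
    (h : MultilinearMap R (fun _ : Fin r => A) A) :
    gcirc hr (show p + q + r - 2 + 1 = (p + q - 1) + r by omega)
        (gcirc hq (show p + q - 1 + 1 = p + q by omega) (⇑f) (⇑g)) (⇑h)
      - gcirc (show 1 ≤ q + r - 1 by omega)
        (show p + q + r - 2 + 1 = p + (q + r - 1) by omega)
        (⇑f) (gcirc hr (show q + r - 1 + 1 = q + r by omega) (⇑g) (⇑h))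
    = ((-1 : ℤ) ^ ((q - 1) * (r - 1))) •
      (gcirc hq (show p + q + r - 2 + 1 = (p + r - 1) + q by omega)
          (gcirc hr (show p + r - 1 + 1 = p + r by omega) (⇑f) (⇑h)) (⇑g)
        - gcirc (show 1 ≤ r + q - 1 by omega)
          (show p + q + r - 2 + 1 = p + (r + q - 1) by omega)
          (⇑f) (gcirc hq (show r + q - 1 + 1 = r + q by omega) (⇑h) (⇑g))) := by
  funext a
  simp only [Pi.sub_apply, Pi.smul_apply]
  rw [assoc_expand, assoc_expand,
    cross hq hr _ _ (show p + r - 1 + 1 = p + r by omega)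
      (show p + q + r - 2 + 1 = (p + r - 1) + q by omega),
    cross hr hq _ _ (show p + q - 1 + 1 = p + q by omega)
      (show p + q + r - 2 + 1 = (p + q - 1) + r by omega),
    smul_add, smul_smul, mul_comm (r - 1) (q - 1), ← mul_pow, neg_one_mul, neg_neg, one_pow,
    one_smul, add_comm]
end

section
/- Fix a commutative ring R and an R-module A. Let f be a p-cochain, g a q-cochain and h an r-cochain. Then the Gerstenhaber bracket satisfies the graded Jacobi identity at the cochain level: (−1)^{(p−1)(r−1)} {{f,g},h} + (−1)^{(q−1)(p−1)} {{g,h},f} + (−1)^{(r−1)(q−1)} {{h,f},g} = 0 as (p+q+r−2)-cochains. -/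
/-- The Gerstenhaber bracket of a `p`-cochain `f` and a `q`-cochain `g`:
`{f,g} = f∘g − (−1)^{(p−1)(q−1)} g∘f`, a `(p+q−1)`-cochain. -/
def gbracket {A : Type*} [AddCommGroup A] {p q n : ℕ} (hp : 1 ≤ p) (hq : 1 ≤ q)
    (hn : n + 1 = p + q) (f : (Fin p → A) → A) (g : (Fin q → A) → A) :
    (Fin n → A) → A :=
  gcirc hq hn f g - ((-1 : ℤ) ^ ((p - 1) * (q - 1))) • gcirc hp (by omega) g f

namespace GJ

variable {A : Type*}

/-- extension of a cochain to sequences -/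
def L {n : ℕ} (f : (Fin n → A) → A) : (ℕ → A) → A := fun x => f fun k => x k.val

def pc (b : ℕ) (F G : (ℕ → A) → A) (i : ℕ) : (ℕ → A) → A := fun x =>
  F fun k => if k < i then x k else if k = i then G (fun l => x (i + l)) else x (k + b)

def C [AddCommGroup A] (P b : ℕ) (F G : (ℕ → A) → A) : (ℕ → A) → A := fun x =>
  ∑ i ∈ Finset.range P, ((-1 : ℤ) ^ (i * b)) • pc b F G i x

def B [AddCommGroup A] (a b : ℕ) (F G : (ℕ → A) → A) : (ℕ → A) → A :=
  C (a + 1) b F G - ((-1 : ℤ) ^ (a * b)) • C (b + 1) a G F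

def Loc (b : ℕ) (G : (ℕ → A) → A) : Prop := ∀ x y, (∀ k ≤ b, x k = y k) → G x = G y

def Add [AddCommGroup A] (a : ℕ) (F : (ℕ → A) → A) : Prop :=
  ∀ i ≤ a, ∀ x : ℕ → A, ∃ φ : A →+ A, ∀ u, F (Function.update x i u) = φ u

theorem L_inj [AddCommGroup A] {n : ℕ} {f g : (Fin n → A) → A} (h : L f = L g) : f = g := by
  funext a
  have := congrFun h (fun k => if hk : k < n then a ⟨k, hk⟩ else 0)
  simpa [L] using this

theorem L_pcomp {p q n : ℕ} (hq : 1 ≤ q) (hn : n + 1 = p + q)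
    (f : (Fin p → A) → A) (g : (Fin q → A) → A) (i : ℕ) :
    L (pcomp hq hn f g (i + 1)) = pc (q - 1) (L f) (L g) i := by
  funext x
  simp only [L, pcomp, pc]
  congr 1
  funext k
  by_cases h1 : k.val < i
  · simp [h1]
  · by_cases h2 : k.val = i
    · simp [h2]
    · simp only [add_lt_add_iff_right, h1, if_false, add_left_inj, h2]
      congr 1
      omega

theorem L_gcirc [AddCommGroup A] {p q n : ℕ} (hq : 1 ≤ q) (hn : n + 1 = p + q)
    (f : (Fin p → A) → A) (g : (Fin q → A) → A) :
    L (gcirc hq hn f g) = C p (q - 1) (L f) (L g) := by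
  funext x
  obtain ⟨b, rfl⟩ : ∃ b, q = b + 1 := ⟨q - 1, by omega⟩
  simp only [C, ← L_pcomp hq hn]
  simp only [L, gcirc]
  have e := Finset.sum_Ico_add' (fun i => ((-1 : ℤ) ^ ((i - 1) * (b + 1 - 1))) •
    pcomp hq hn f g i fun k => x k.val) 0 p 1
  simp only [Nat.add_sub_cancel] at e ⊢
  rw [Finset.range_eq_Ico, e]
  refine Finset.sum_congr (by ext; simp) ?_
  intro i _
  congr 1
  rw [show (i - 1) * (b + 1 + 1) = (i - 1) * b + 2 * (i - 1) by ring, pow_add, pow_mul _ 2]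
  simp

theorem L_gbracket [AddCommGroup A] {p q n : ℕ} (hp : 1 ≤ p) (hq : 1 ≤ q) (hn : n + 1 = p + q)
    (f : (Fin p → A) → A) (g : (Fin q → A) → A) :
    L (gbracket hp hq hn f g) = B (p - 1) (q - 1) (L f) (L g) := by
  rw [B, show p - 1 + 1 = p by omega, show q - 1 + 1 = q by omega, ← L_gcirc hq hn,
    ← L_gcirc hp (by omega : n + 1 = q + p)]
  rfl

theorem Loc_L {b : ℕ} (f : (Fin (b + 1) → A) → A) : Loc b (L f) := by
  intro x y h
  simp only [L]
  congr 1
  funext k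
  exact h _ (by omega)

theorem Add_L {R : Type*} [CommRing R] [AddCommGroup A] [Module R A] {a : ℕ}
    (f : MultilinearMap R (fun _ : Fin (a + 1) => A) A) : Add a (L (⇑f)) := by
  intro i hi x
  refine ⟨(f.toLinearMap (fun k => x k.val) ⟨i, by omega⟩).toAddMonoidHom, fun u => ?_⟩
  simp only [L, LinearMap.toAddMonoidHom_coe, MultilinearMap.toLinearMap_apply]
  congr 1
  funext k
  simp [Function.update_apply, Fin.ext_iff]

theorem pc_hom [AddCommGroup A] {a : ℕ} {F : (ℕ → A) → A} (hF : Add a F) (b i : ℕ) (hi : i ≤ a)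
    (x : ℕ → A) : ∃ φ : A →+ A, ∀ G, pc b F G i x = φ (G fun l => x (i + l)) := by
  obtain ⟨φ, hφ⟩ := hF i hi (fun k => if k < i then x k else x (k + b))
  refine ⟨φ, fun G => ?_⟩
  rw [← hφ, pc]
  congr 1
  funext k
  by_cases h2 : k = i
  · subst h2; simp
  · simp [Function.update_apply, h2]

theorem pc_lt (b c : ℕ) (F G H : (ℕ → A) → A) (i j : ℕ) (hj : j < i) (hH : Loc c H) :
    pc c (pc b F G i) H j = pc b (pc c F H j) G (i + c) := by
  funext x
  simp only [pc]
  congr 1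
  funext k
  rcases lt_trichotomy k j with h | h | h
  · have : k < i := by omega
    have : k < i + c := by omega
    simp [*]
  · subst h
    simp only [hj, if_true, lt_irrefl, if_false]
    apply hH
    intro l hl
    rw [if_pos (by omega)]
  · rcases lt_trichotomy k i with h' | h' | h'
    · rw [if_pos h', if_neg (by omega), if_neg (by omega), if_neg (by omega), if_neg (by omega),
        if_pos (by omega)]
    · subst h'
      simp only [lt_irrefl, if_false, if_true, show ¬ k < j by omega, show ¬ k = j by omega]
      congr 1
      funext l
      rw [if_neg (by omega), if_neg (by omega)]
      congr 1
      omega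
    · rw [if_neg (by omega), if_neg (by omega), if_neg (by omega), if_neg (by omega),
        if_neg (by omega), if_neg (by omega), if_neg (by omega), if_neg (by omega)]
      congr 1
      omega

theorem pc_mid (b c : ℕ) (F G H : (ℕ → A) → A) (i l : ℕ) (hl : l ≤ b) :
    pc c (pc b F G i) H (i + l) = pc (b + c) F (pc c G H l) i := by
  funext x
  simp only [pc]
  congr 1
  funext k
  rcases lt_trichotomy k i with h | h | h
  · rw [if_pos h, if_pos h, if_pos (by omega)]
  · subst h
    simp only [lt_irrefl, if_false, if_true]
    congr 1
    funext m
    rcases lt_trichotomy m l with h | h | h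
    · rw [if_pos h, if_pos (by omega)]
    · subst h
      simp [add_assoc]
    · rw [if_neg (by omega), if_neg (by omega), if_neg (by omega), if_neg (by omega), add_assoc]
  · rw [if_neg (by omega), if_neg (by omega), if_neg (by omega), if_neg (by omega),
      if_neg (by omega), if_neg (by omega), add_assoc]

theorem sum_split [AddCommGroup A] (a b i : ℕ) (hi : i < a + 1) (t : ℕ → A) :
    ∑ j ∈ Finset.range (a + b + 1), t j =
      (∑ j ∈ Finset.range (a + 1), if j < i then t j else 0)
      + (∑ l ∈ Finset.range (b + 1), t (i + l))
      + ∑ j ∈ Finset.range (a + 1), if i < j then t (j + b) else 0 := by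
  obtain ⟨d, rfl⟩ : ∃ d, a = i + d := ⟨a - i, by omega⟩
  have e1 : ∑ j ∈ Finset.range (i + d + 1), (if j < i then t j else 0)
      = ∑ j ∈ Finset.range i, t j := by
    rw [← Finset.sum_filter]
    refine Finset.sum_congr (by ext; simp; omega) fun _ _ => rfl
  have e2 : ∑ j ∈ Finset.range (i + d + 1), (if i < j then t (j + b) else 0)
      = ∑ m ∈ Finset.range d, t (i + (b + 1) + m) := by
    rw [show i + d + 1 = (i + 1) + d by ring, Finset.sum_range_add, Finset.sum_eq_zero, zero_add]
    · refine Finset.sum_congr rfl fun m _ => ?_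
      rw [if_pos (by omega)]
      congr 1
      omega
    · intro j hj
      rw [if_neg]
      simp at hj
      omega
  rw [e1, e2, show i + d + b + 1 = i + (b + 1) + d by ring, Finset.sum_range_add,
    Finset.sum_range_add]

def T [AddCommGroup A] (a b c : ℕ) (F G H : (ℕ → A) → A) (x : ℕ → A) : A :=
  ∑ i ∈ Finset.range (a + 1), ∑ j ∈ Finset.range (a + 1),
    if j < i then ((-1 : ℤ) ^ (i * b + j * c)) • pc c (pc b F G i) H j x else 0

theorem CC [AddCommGroup A] (a b P c : ℕ) (F G H : (ℕ → A) → A) (x : ℕ → A) :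
    C P c (C (a + 1) b F G) H x = ∑ i ∈ Finset.range (a + 1), ∑ j ∈ Finset.range P,
      ((-1 : ℤ) ^ (i * b + j * c)) • pc c (pc b F G i) H j x := by
  rw [Finset.sum_comm]
  simp only [C]
  refine Finset.sum_congr rfl fun j _ => ?_
  have e : pc c (C (a + 1) b F G) H j x
      = ∑ i ∈ Finset.range (a + 1), ((-1 : ℤ) ^ (i * b)) • pc c (pc b F G i) H j x := rfl
  rw [e, Finset.smul_sum]
  refine Finset.sum_congr rfl fun i _ => ?_
  rw [smul_smul, pow_add, mul_comm]

theorem CR [AddCommGroup A] (a b c : ℕ) (F G H : (ℕ → A) → A) (hF : Add a F) (x : ℕ → A) :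
    C (a + 1) (b + c) F (C (b + 1) c G H) x =
     ∑ i ∈ Finset.range (a + 1), ∑ l ∈ Finset.range (b + 1),
      ((-1 : ℤ) ^ (i * b + (i + l) * c)) • pc (b + c) F (pc c G H l) i x := by
  rw [C]
  refine Finset.sum_congr rfl fun i hi => ?_
  obtain ⟨φ, hφ⟩ := pc_hom hF (b + c) i (by simp at hi; omega) x
  simp only [hφ, C, map_sum, map_zsmul, Finset.smul_sum, smul_smul]
  refine Finset.sum_congr rfl fun l hi => ?_
  rw [← pow_add]
  congr 2
  ring

theorem assoc [AddCommGroup A] (a b c : ℕ) (F G H : (ℕ → A) → A) (hF : Add a F)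
    (hG : Loc b G) (x : ℕ → A) :
    C (a + b + 1) c (C (a + 1) b F G) H x - C (a + 1) (b + c) F (C (b + 1) c G H) x
      = T a b c F G H x + ((-1 : ℤ) ^ (b * c)) • T a c b F H G x := by
  rw [CC, CR a b c F G H hF, sub_eq_iff_eq_add]
  have e : T a c b F H G x = ∑ i ∈ Finset.range (a + 1), ∑ j ∈ Finset.range (a + 1),
    if i < j then ((-1 : ℤ) ^ (j * c + i * b)) • pc b (pc c F H j) G i x else 0 := by
    rw [T, Finset.sum_comm]
  rw [e, T, Finset.smul_sum, ← Finset.sum_add_distrib, ← Finset.sum_add_distrib]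
  refine Finset.sum_congr rfl fun i hi => ?_
  rw [sum_split a b i (by simpa using hi), add_right_comm]
  congr 1
  · congr 1
    rw [Finset.smul_sum]
    refine Finset.sum_congr rfl fun j hj => ?_
    split_ifs with h
    · rw [smul_smul, ← pow_add, ← pc_lt c b F H G j i h hG]
      congr 2
      ring
    · simp
  · refine Finset.sum_congr rfl fun l hl => ?_
    rw [pc_mid _ _ _ _ _ _ _ (by simp at hl; omega)]

theorem prelie [AddCommGroup A] (a b c : ℕ) (F G H : (ℕ → A) → A) (hF : Add a F)
    (hG : Loc b G) (hH : Loc c H) (x : ℕ → A) :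
    C (a + b + 1) c (C (a + 1) b F G) H x - C (a + 1) (b + c) F (C (b + 1) c G H) x
      = ((-1 : ℤ) ^ (b * c)) • (C (a + c + 1) b (C (a + 1) c F H) G x
        - C (a + 1) (b + c) F (C (c + 1) b H G) x) := by
  have h2 := assoc a c b F H G hF hH x
  rw [add_comm c b] at h2
  rw [assoc a b c F G H hF hG, h2, smul_add, smul_smul, mul_comm c b, ← mul_pow]
  simp [add_comm]

theorem C_left [AddCommGroup A] (P b : ℕ) (s : ℤ) (F F' G : (ℕ → A) → A) (x : ℕ → A) :
    C P b (F - s • F') G x = C P b F G x - s • C P b F' G x := by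
  simp only [C, Finset.smul_sum, ← Finset.sum_sub_distrib]
  refine Finset.sum_congr rfl fun i _ => ?_
  rw [smul_comm s, ← smul_sub]
  rfl

theorem C_right [AddCommGroup A] (a b : ℕ) (s : ℤ) (F G G' : (ℕ → A) → A) (hF : Add a F)
    (x : ℕ → A) :
    C (a + 1) b F (G - s • G') x = C (a + 1) b F G x - s • C (a + 1) b F G' x := by
  simp only [C, Finset.smul_sum, ← Finset.sum_sub_distrib]
  refine Finset.sum_congr rfl fun i hi => ?_
  obtain ⟨φ, hφ⟩ := pc_hom hF b i (by simp at hi; omega) x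
  rw [smul_comm s, ← smul_sub]
  simp [hφ]

theorem BB [AddCommGroup A] (a b c : ℕ) (F G H : (ℕ → A) → A) (hH : Add c H) (x : ℕ → A) :
    B (a + b) c (B a b F G) H x =
      C (a + b + 1) c (C (a + 1) b F G) H x
      - ((-1 : ℤ) ^ (a * b)) • C (a + b + 1) c (C (b + 1) a G F) H x
      - ((-1 : ℤ) ^ ((a + b) * c)) • (C (c + 1) (a + b) H (C (a + 1) b F G) x
        - ((-1 : ℤ) ^ (a * b)) • C (c + 1) (a + b) H (C (b + 1) a G F) x) := by
  rw [← C_left, ← C_right _ _ _ _ _ _ hH]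
  rfl

theorem jac [AddCommGroup A] (a b c : ℕ) (F G H : (ℕ → A) → A) (hF : Add a F) (hG : Add b G)
    (hH : Add c H) (lF : Loc a F) (lG : Loc b G) (lH : Loc c H) (x : ℕ → A) :
    ((-1 : ℤ) ^ (a * c)) • B (a + b) c (B a b F G) H x
    + ((-1 : ℤ) ^ (b * a)) • B (b + c) a (B b c G H) F x
    + ((-1 : ℤ) ^ (c * b)) • B (c + a) b (B c a H F) G x = 0 := by
  rw [BB _ _ _ _ _ _ hH, BB _ _ _ _ _ _ hF, BB _ _ _ _ _ _ hG]
  have h1 := prelie a b c F G H hF lG lH x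
  have h2 := prelie b c a G H F hG lH lF x
  have h3 := prelie c a b H F G hH lF lG x
  simp only [add_mul, pow_add, mul_comm b a, mul_comm c b, mul_comm c a, add_comm b a,
    add_comm c b, add_comm c a] at h1 h2 h3 ⊢
  have s := neg_one_pow_eq_or ℤ (a * b)
  have t := neg_one_pow_eq_or ℤ (b * c)
  have u := neg_one_pow_eq_or ℤ (a * c)
  generalize (-1 : ℤ) ^ (a * b) = σ at *
  generalize (-1 : ℤ) ^ (b * c) = τ at *
  generalize (-1 : ℤ) ^ (a * c) = υ at *
  rcases s with rfl | rfl <;> rcases t with rfl | rfl <;> rcases u with rfl | rfl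
  · linear_combination (norm := module) (1 : ℤ) • h1 + (1 : ℤ) • h2 + (1 : ℤ) • h3
  · linear_combination (norm := module) (-1 : ℤ) • h1 + (1 : ℤ) • h2 + (1 : ℤ) • h3
  · linear_combination (norm := module) (1 : ℤ) • h1 + (1 : ℤ) • h2 + (-1 : ℤ) • h3
  · linear_combination (norm := module) (-1 : ℤ) • h1 + (1 : ℤ) • h2 + (-1 : ℤ) • h3
  · linear_combination (norm := module) (1 : ℤ) • h1 + (-1 : ℤ) • h2 + (1 : ℤ) • h3
  · linear_combination (norm := module) (-1 : ℤ) • h1 + (-1 : ℤ) • h2 + (1 : ℤ) • h3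
  · linear_combination (norm := module) (1 : ℤ) • h1 + (-1 : ℤ) • h2 + (-1 : ℤ) • h3
  · linear_combination (norm := module) (-1 : ℤ) • h1 + (-1 : ℤ) • h2 + (-1 : ℤ) • h3

end GJ

/-- The Gerstenhaber bracket satisfies the graded Jacobi identity at the
cochain level:
`(−1)^{(p−1)(r−1)} {{f,g},h} + (−1)^{(q−1)(p−1)} {{g,h},f} + (−1)^{(r−1)(q−1)} {{h,f},g} = 0`
as `(p+q+r−2)`-cochains. -/
theorem gerstenhaber_bracket_graded_jacobi {R A : Type*} [CommRing R] [AddCommGroup A]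
    [Module R A]
    {p q r : ℕ} (hp : 1 ≤ p) (hq : 1 ≤ q) (hr : 1 ≤ r)
    (f : MultilinearMap R (fun _ : Fin p => A) A)
    (g : MultilinearMap R (fun _ : Fin q => A) A)
    (h : MultilinearMap R (fun _ : Fin r => A) A) :
    ((-1 : ℤ) ^ ((p - 1) * (r - 1))) •
        gbracket (show 1 ≤ p + q - 1 by omega) hr
          (show p + q + r - 2 + 1 = (p + q - 1) + r by omega)
          (gbracket hp hq (show p + q - 1 + 1 = p + q by omega) (⇑f) (⇑g)) (⇑h)
      + ((-1 : ℤ) ^ ((q - 1) * (p - 1))) •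
        gbracket (show 1 ≤ q + r - 1 by omega) hp
          (show p + q + r - 2 + 1 = (q + r - 1) + p by omega)
          (gbracket hq hr (show q + r - 1 + 1 = q + r by omega) (⇑g) (⇑h)) (⇑f)
      + ((-1 : ℤ) ^ ((r - 1) * (q - 1))) •
        gbracket (show 1 ≤ r + p - 1 by omega) hq
          (show p + q + r - 2 + 1 = (r + p - 1) + q by omega)
          (gbracket hr hp (show r + p - 1 + 1 = r + p by omega) (⇑h) (⇑f)) (⇑g)
    = 0 := by
  apply GJ.L_inj
  funext x
  obtain ⟨a, rfl⟩ : ∃ a, p = a + 1 := ⟨p - 1, by omega⟩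
  obtain ⟨b, rfl⟩ : ∃ b, q = b + 1 := ⟨q - 1, by omega⟩
  obtain ⟨c, rfl⟩ : ∃ c, r = c + 1 := ⟨r - 1, by omega⟩
  have key := GJ.jac a b c (GJ.L (⇑f)) (GJ.L (⇑g)) (GJ.L (⇑h)) (GJ.Add_L f) (GJ.Add_L g)
    (GJ.Add_L h) (GJ.Loc_L _) (GJ.Loc_L _) (GJ.Loc_L _) x
  have e : ∀ m n : ℕ, m + 1 + (n + 1) - 1 - 1 = m + n := by omega
  have e1 := congrFun (GJ.L_gbracket (show 1 ≤ a + 1 + (b + 1) - 1 by omega) hr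
    (show a + 1 + (b + 1) + (c + 1) - 2 + 1 = (a + 1 + (b + 1) - 1) + (c + 1) by omega)
    (gbracket hp hq (by omega) (⇑f) (⇑g)) (⇑h)) x
  have e2 := congrFun (GJ.L_gbracket (show 1 ≤ b + 1 + (c + 1) - 1 by omega) hp
    (show a + 1 + (b + 1) + (c + 1) - 2 + 1 = (b + 1 + (c + 1) - 1) + (a + 1) by omega)
    (gbracket hq hr (by omega) (⇑g) (⇑h)) (⇑f)) x
  have e3 := congrFun (GJ.L_gbracket (show 1 ≤ c + 1 + (a + 1) - 1 by omega) hq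
    (show a + 1 + (b + 1) + (c + 1) - 2 + 1 = (c + 1 + (a + 1) - 1) + (b + 1) by omega)
    (gbracket hr hp (by omega) (⇑h) (⇑f)) (⇑g)) x
  rw [GJ.L_gbracket hp hq] at e1
  rw [GJ.L_gbracket hq hr] at e2
  rw [GJ.L_gbracket hr hp] at e3
  simp only [e, Nat.add_sub_cancel] at e1 e2 e3
  rw [← e1, ← e2, ← e3] at key
  exact key
end

section
/- Fix a commutative ring R and an R-module A. Let f be a p-cochain, g a q-cochain and h an r-cochain, let ∘ denote the ungraded circle product, and set [f,g] := f∘g − g∘f. Then the Jacobi identity holds: [[f,g],h] + [[g,h],f] + [[h,f],g] = 0 as (p+q+r−2)-cochains. -/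
/-- The commutator bracket of the ungraded circle product:
`[f,g] = f∘g − g∘f`, a `(p+q−1)`-cochain. -/
def abracket {A : Type*} [AddCommGroup A] {p q n : ℕ} (hp : 1 ≤ p) (hq : 1 ≤ q)
    (hn : n + 1 = p + q) (f : (Fin p → A) → A) (g : (Fin q → A) → A) :
    (Fin n → A) → A :=
  circ hq hn f g - circ hp (by omega) g f

theorem aux_seq {A : Type*} {p q r m m' n : ℕ} (hq : 1 ≤ q) (hr : 1 ≤ r)
    (hm : m + 1 = p + q) (hm' : m' + 1 = q + r) (hmm : 1 ≤ m') (hn : n + 1 = m + r)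
    (hn' : n + 1 = p + m')
    (f : (Fin p → A) → A) (g : (Fin q → A) → A) (h : (Fin r → A) → A) (i j : ℕ)
    (hi : 1 ≤ i) (hj : 1 ≤ j) (hjq : j ≤ q) :
    pcomp hr hn (pcomp hq hm f g i) h (i + j - 1) = pcomp hmm hn' f (pcomp hr hm' g h j) i := by
  funext a
  simp only [pcomp]
  congr 1
  funext k
  have hk := k.isLt
  rcases lt_trichotomy (k.val + 1) i with h1 | h1 | h1
  · rw [if_pos h1, if_pos h1, if_pos (by omega)]
  · rw [if_neg (by omega), if_pos h1, if_neg (by omega), if_pos h1]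
    congr 1
    funext l
    have hl := l.isLt
    rcases lt_trichotomy (l.val + 1) j with h2 | h2 | h2
    · rw [if_pos h2, if_pos (by omega)]
    · rw [if_neg (by omega), if_pos (by omega), if_neg (by omega), if_pos h2]
      congr 1
      funext s
      congr 1
      apply Fin.ext
      simp only
      omega
    · rw [if_neg (by omega), if_neg (by omega), if_neg (by omega),
        if_neg (by omega)]
      congr 1
      apply Fin.ext
      simp only
      omega
  · rw [if_neg (by omega), if_neg (by omega), if_neg (by omega),
      if_neg (by omega), if_neg (by omega), if_neg (by omega)]
    congr 1
    apply Fin.ext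
    simp only
    omega

theorem aux_par {A : Type*} {p q r m m' n : ℕ} (hq : 1 ≤ q) (hr : 1 ≤ r)
    (hm : m + 1 = p + q) (hm' : m' + 1 = p + r) (hn : n + 1 = m + r)
    (hn' : n + 1 = m' + q)
    (f : (Fin p → A) → A) (g : (Fin q → A) → A) (h : (Fin r → A) → A) (i k : ℕ)
    (hi : 1 ≤ i) (hik : i < k) :
    pcomp hr hn (pcomp hq hm f g i) h (k + q - 1) = pcomp hq hn' (pcomp hr hm' f h k) g i := by
  funext a
  simp only [pcomp]
  congr 1
  funext t
  have ht := t.isLt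
  rcases lt_trichotomy (t.val + 1) i with h1 | h1 | h1
  · rw [if_pos h1, if_pos (by omega), if_pos (by omega), if_pos (by omega)]
  · rw [if_neg (by omega), if_pos h1, if_pos (by omega), if_neg (by omega),
      if_pos (by omega)]
    congr 1
    funext l
    have hl := l.isLt
    rw [if_pos (by omega)]
  · rw [if_neg (by omega), if_neg (by omega)]
    rcases lt_trichotomy (t.val + 1) k with h2 | h2 | h2
    · rw [if_pos h2, if_pos (by omega), if_neg (by omega),
        if_neg (by omega)]
    · rw [if_neg (by omega), if_pos (by omega), if_neg (by omega),
        if_pos h2]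
      congr 1
      funext s
      rw [if_neg (by omega), if_neg (by omega)]
      congr 1
      apply Fin.ext
      simp only
      omega
    · rw [if_neg (by omega), if_neg (by omega), if_neg (by omega),
        if_neg (by omega), if_neg (by omega), if_neg (by omega)]
      congr 1
      apply Fin.ext
      simp only
      omega

theorem aux_upd {R A : Type*} [CommRing R] [AddCommGroup A] [Module R A] {p q n : ℕ}
    (hq : 1 ≤ q) (hn : n + 1 = p + q)
    (f : MultilinearMap R (fun _ : Fin p => A) A) (i : ℕ) (hi : 1 ≤ i) (hip : i ≤ p)
    (a : Fin n → A) : ∃ (b : Fin p → A) (c : Fin q → A), ∀ g : (Fin q → A) → A,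
      pcomp hq hn (⇑f) g i a = f (Function.update b ⟨i - 1, by omega⟩ (g c)) := by
  refine ⟨fun k => if k.val + 1 < i then a ⟨k.val, by have hk := k.isLt; omega⟩
    else a ⟨k.val + q - 1, by have hk := k.isLt; omega⟩,
    fun l => a ⟨i - 1 + l.val, by have hl := l.isLt; omega⟩, fun g => ?_⟩
  unfold pcomp
  congr 1
  funext k
  have hk := k.isLt
  rcases lt_trichotomy (k.val + 1) i with h1 | h1 | h1
  · rw [if_pos h1, Function.update_of_ne (by intro e; simp [e] at h1; omega), if_pos h1]
  · subst h1
    have e : (⟨k.val + 1 - 1, by omega⟩ : Fin p) = k := Fin.ext (by simp)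
    rw [if_neg (by omega), if_pos rfl, e, Function.update_self]
    simp only [Nat.add_sub_cancel]
  · rw [if_neg (by omega), if_neg (by omega),
      Function.update_of_ne (by intro e; simp [e] at h1; omega), if_neg (by omega)]

theorem aux_pcomp_sub {R A : Type*} [CommRing R] [AddCommGroup A] [Module R A] {p q n : ℕ}
    (hq : 1 ≤ q) (hn : n + 1 = p + q)
    (f : MultilinearMap R (fun _ : Fin p => A) A) (i : ℕ) (hi : 1 ≤ i) (hip : i ≤ p)
    (g g' : (Fin q → A) → A) :
    pcomp hq hn (⇑f) (g - g') i = pcomp hq hn (⇑f) g i - pcomp hq hn (⇑f) g' i := by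
  funext a
  obtain ⟨b, c, hbc⟩ := aux_upd hq hn f i hi hip a
  simp only [Pi.sub_apply, hbc, MultilinearMap.map_update_sub]

theorem aux_circ_sub {R A : Type*} [CommRing R] [AddCommGroup A] [Module R A] {p q n : ℕ}
    (hq : 1 ≤ q) (hn : n + 1 = p + q)
    (f : MultilinearMap R (fun _ : Fin p => A) A)
    (g g' : (Fin q → A) → A) :
    circ hq hn (⇑f) (g - g') = circ hq hn (⇑f) g - circ hq hn (⇑f) g' := by
  funext a
  simp only [circ, Pi.sub_apply, ← Finset.sum_sub_distrib]
  refine Finset.sum_congr rfl fun i hi => ?_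
  rw [Finset.mem_Icc] at hi
  rw [aux_pcomp_sub hq hn f i hi.1 hi.2, Pi.sub_apply]

theorem aux_sub_circ {A : Type*} [AddCommGroup A] {p q n : ℕ}
    (hq : 1 ≤ q) (hn : n + 1 = p + q) (f f' : (Fin p → A) → A) (g : (Fin q → A) → A) :
    circ hq hn (f - f') g = circ hq hn f g - circ hq hn f' g := by
  funext a
  simp only [circ, Pi.sub_apply, ← Finset.sum_sub_distrib]
  rfl

theorem aux_circ_circ {R A : Type*} [CommRing R] [AddCommGroup A] [Module R A]
    {p q r m n : ℕ} (hr : 1 ≤ r) (hm : m + 1 = q + r) (hmm : 1 ≤ m) (hn : n + 1 = p + m)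
    (f : MultilinearMap R (fun _ : Fin p => A) A)
    (g : (Fin q → A) → A) (h : (Fin r → A) → A) (a : Fin n → A) :
    circ hmm hn (⇑f) (circ hr hm g h) a =
      ∑ i ∈ Finset.Icc 1 p, ∑ j ∈ Finset.Icc 1 q,
        pcomp hmm hn (⇑f) (pcomp hr hm g h j) i a := by
  rw [circ]
  refine Finset.sum_congr rfl fun i hi => ?_
  rw [Finset.mem_Icc] at hi
  obtain ⟨b, c, hbc⟩ := aux_upd hmm hn f i hi.1 hi.2 a
  simp only [hbc, circ, MultilinearMap.map_update_sum]

theorem aux_split {A : Type*} [AddCommGroup A] {p q m i : ℕ} (hq : 1 ≤ q) (hm : m + 1 = p + q)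
    (hi : 1 ≤ i) (hip : i ≤ p) (F : ℕ → A) :
    ∑ j ∈ Finset.Icc 1 m, F j = ∑ j ∈ Finset.Icc 1 q, F (i + j - 1) +
      (∑ j ∈ Finset.Ico 1 i, F j + ∑ k ∈ Finset.Ioc i p, F (k + q - 1)) := by
  have e1 : Finset.Icc 1 m = Finset.Ico 1 (m + 1) := by ext; simp only [Finset.mem_Icc, Finset.mem_Ico]; omega
  have e2 : ∑ j ∈ Finset.Icc 1 q, F (i + j - 1) = ∑ j ∈ Finset.Ico i (i + q), F j := by
    refine Finset.sum_bij' (fun j _ => i + j - 1) (fun j _ => j + 1 - i) ?_ ?_ ?_ ?_ ?_ <;>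
      simp only [Finset.mem_Icc, Finset.mem_Ico] <;> intros <;> first | omega | trivial
  have e3 : ∑ k ∈ Finset.Ioc i p, F (k + q - 1) = ∑ j ∈ Finset.Ico (i + q) (m + 1), F j := by
    refine Finset.sum_bij' (fun j _ => j + q - 1) (fun j _ => j + 1 - q) ?_ ?_ ?_ ?_ ?_ <;>
      simp only [Finset.mem_Ioc, Finset.mem_Ico] <;> intros <;> first | omega | trivial
  rw [e1, e2, e3, ← Finset.sum_Ico_consecutive F hi (show i ≤ m + 1 by omega),
    ← Finset.sum_Ico_consecutive F (show i ≤ i + q by omega) (show i + q ≤ m + 1 by omega)]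
  abel

theorem aux_assoc {R A : Type*} [CommRing R] [AddCommGroup A] [Module R A]
    {p q r m₁ m₂ m₃ n : ℕ} (hq : 1 ≤ q) (hr : 1 ≤ r)
    (h₁ : m₁ + 1 = p + q) (h₂ : m₂ + 1 = q + r) (h₃ : m₃ + 1 = p + r) (hm₂ : 1 ≤ m₂)
    (hn₁ : n + 1 = m₁ + r) (hn₂ : n + 1 = p + m₂) (hn₃ : n + 1 = m₃ + q)
    (f : MultilinearMap R (fun _ : Fin p => A) A)
    (g : (Fin q → A) → A) (h : (Fin r → A) → A) (a : Fin n → A) :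
    circ hr hn₁ (circ hq h₁ (⇑f) g) h a = circ hm₂ hn₂ (⇑f) (circ hr h₂ g h) a +
      (∑ i ∈ Finset.Icc 1 p, ∑ j ∈ Finset.Ico 1 i, pcomp hr hn₁ (pcomp hq h₁ (⇑f) g i) h j a +
       ∑ i ∈ Finset.Icc 1 p, ∑ j ∈ Finset.Ico 1 i,
        pcomp hq hn₃ (pcomp hr h₃ (⇑f) h i) g j a) := by
  have e : circ hr hn₁ (circ hq h₁ (⇑f) g) h a = ∑ i ∈ Finset.Icc 1 p,
      ∑ j ∈ Finset.Icc 1 m₁, pcomp hr hn₁ (pcomp hq h₁ (⇑f) g i) h j a := by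
    rw [Finset.sum_comm]
    rfl
  have e' : ∑ i ∈ Finset.Icc 1 p, ∑ j ∈ Finset.Ico 1 i,
        pcomp hq hn₃ (pcomp hr h₃ (⇑f) h i) g j a = ∑ j ∈ Finset.Icc 1 p, ∑ i ∈ Finset.Ioc j p,
        pcomp hq hn₃ (pcomp hr h₃ (⇑f) h i) g j a := by
    apply Finset.sum_comm'
    intro x y
    simp only [Finset.mem_Icc, Finset.mem_Ico, Finset.mem_Ioc]
    omega
  rw [e, e', aux_circ_circ, ← Finset.sum_add_distrib, ← Finset.sum_add_distrib]
  refine Finset.sum_congr rfl fun i hi => ?_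
  rw [Finset.mem_Icc] at hi
  rw [aux_split hq h₁ hi.1 hi.2]
  congr 1
  · refine Finset.sum_congr rfl fun j hj => ?_
    rw [Finset.mem_Icc] at hj
    rw [aux_seq hq hr h₁ h₂ hm₂ hn₁ hn₂ _ _ _ _ _ hi.1 hj.1 hj.2]
  · congr 1
    refine Finset.sum_congr rfl fun j hj => ?_
    rw [Finset.mem_Ioc] at hj
    rw [aux_par hq hr h₁ h₃ hn₁ hn₃ _ _ _ _ _ hi.1 hj.1]

theorem aux_prelie {R A : Type*} [CommRing R] [AddCommGroup A] [Module R A]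
    {p q r m₁ m₂ m₃ n : ℕ} (hq : 1 ≤ q) (hr : 1 ≤ r)
    (h₁ : m₁ + 1 = p + q) (h₂ : m₂ + 1 = q + r) (h₂' : m₂ + 1 = r + q)
    (h₃ : m₃ + 1 = p + r) (hm₂ : 1 ≤ m₂)
    (hn₁ : n + 1 = m₁ + r) (hn₂ : n + 1 = p + m₂) (hn₃ : n + 1 = m₃ + q)
    (f : MultilinearMap R (fun _ : Fin p => A) A)
    (g : (Fin q → A) → A) (h : (Fin r → A) → A) :
    circ hr hn₁ (circ hq h₁ (⇑f) g) h =
      circ hm₂ hn₂ (⇑f) (circ hr h₂ g h) - circ hm₂ hn₂ (⇑f) (circ hq h₂' h g) +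
      circ hq hn₃ (circ hr h₃ (⇑f) h) g := by
  funext a
  simp only [Pi.add_apply, Pi.sub_apply]
  rw [aux_assoc hq hr h₁ h₂ h₃ hm₂ hn₁ hn₂ hn₃, aux_assoc hr hq h₃ h₂' h₁ hm₂ hn₃ hn₂ hn₁]
  abel

/-- The commutator of the ungraded circle product satisfies the Jacobi
identity: `[[f,g],h] + [[g,h],f] + [[h,f],g] = 0` as `(p+q+r−2)`-cochains. -/
theorem circ_commutator_jacobi {R A : Type*} [CommRing R] [AddCommGroup A] [Module R A]
    {p q r : ℕ} (hp : 1 ≤ p) (hq : 1 ≤ q) (hr : 1 ≤ r)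
    (f : MultilinearMap R (fun _ : Fin p => A) A)
    (g : MultilinearMap R (fun _ : Fin q => A) A)
    (h : MultilinearMap R (fun _ : Fin r => A) A) :
    abracket (show 1 ≤ p + q - 1 by omega) hr
        (show p + q + r - 2 + 1 = (p + q - 1) + r by omega)
        (abracket hp hq (show p + q - 1 + 1 = p + q by omega) (⇑f) (⇑g)) (⇑h)
      + abracket (show 1 ≤ q + r - 1 by omega) hp
        (show p + q + r - 2 + 1 = (q + r - 1) + p by omega)
        (abracket hq hr (show q + r - 1 + 1 = q + r by omega) (⇑g) (⇑h)) (⇑f)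
      + abracket (show 1 ≤ r + p - 1 by omega) hq
        (show p + q + r - 2 + 1 = (r + p - 1) + q by omega)
        (abracket hr hp (show r + p - 1 + 1 = r + p by omega) (⇑h) (⇑f)) (⇑g)
    = 0 := by
  simp only [abracket, aux_circ_sub, aux_sub_circ]
  rw [aux_prelie (m₂ := q + r - 1) (m₃ := r + p - 1) hq hr (by omega) (by omega) (by omega)
      (by omega) (by omega) (by omega) (by omega) (by omega) f,
    aux_prelie (m₂ := r + p - 1) (m₃ := p + q - 1) hr hp (by omega) (by omega) (by omega)
      (by omega) (by omega) (by omega) (by omega) (by omega) g,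
    aux_prelie (m₂ := p + q - 1) (m₃ := q + r - 1) hp hq (by omega) (by omega) (by omega)
      (by omega) (by omega) (by omega) (by omega) (by omega) h]
  abel
end

section
/- Let r be an n-tuple, s an m-tuple and t an l-tuple of positive real numbers (n, m, l ≥ 1), and let 1 ≤ i ≤ n and 1 ≤ j ≤ m. Then the scaling-operad compositions satisfy the sequential associativity relation (r ∘ᵢ s) ∘_{i+j−1} t = r ∘ᵢ (s ∘ⱼ t) as (n+m+l−2)-tuples of positive reals. -/
/-- The scaling-operad composition: for an `n`-tuple `r` and an `m`-tuple `s` of reals and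
`1 ≤ i ≤ n`, `r ∘ᵢ s = (r₁,…,r_{i−1}, (rᵢ/S)s₁,…,(rᵢ/S)s_m, r_{i+1},…,rₙ)` where
`S = Σ_k s_k`, an `N`-tuple with `N + 1 = n + m` (i.e. `N = n + m − 1`). -/
noncomputable def scomp {n m N : ℕ} (i : ℕ) (h1 : 1 ≤ i) (h2 : i ≤ n) (hm : 1 ≤ m)
    (hN : N + 1 = n + m) (r : Fin n → ℝ) (s : Fin m → ℝ) : Fin N → ℝ :=
  fun k =>
    if hk1 : k.val + 1 < i then r ⟨k.val, by omega⟩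
    else if hk2 : k.val < i - 1 + m then
      (r ⟨i - 1, by omega⟩ / ∑ l, s l) * s ⟨k.val - (i - 1), by omega⟩
    else r ⟨k.val - m + 1, by have hk := k.isLt; omega⟩

theorem scomp_sum {n m N : ℕ} (i : ℕ) (h1 : 1 ≤ i) (h2 : i ≤ n) (hm : 1 ≤ m)
    (hN : N + 1 = n + m) (r : Fin n → ℝ) (s : Fin m → ℝ) (hs : ∑ l, s l ≠ 0) :
    ∑ k, scomp i h1 h2 hm hN r s k = ∑ k, r k := by
  obtain ⟨a, rfl⟩ : ∃ a, i = a + 1 := ⟨i - 1, by omega⟩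
  obtain ⟨b, rfl⟩ : ∃ b, n = a + 1 + b := ⟨n - (a + 1), by omega⟩
  obtain rfl : N = a + m + b := by omega
  rw [Fin.sum_univ_add, Fin.sum_univ_add, Fin.sum_univ_add r, Fin.sum_univ_add (a := a) (b := 1)]
  congr 1
  · congr 1
    · refine Finset.sum_congr rfl fun k _ => ?_
      have hk := k.isLt
      simp only [scomp, Fin.val_castAdd]
      rw [dif_pos (by omega)]
      rfl
    · have : ∀ k : Fin m, scomp (a + 1) h1 h2 hm hN r s (Fin.castAdd b (Fin.natAdd a k))
          = (r ⟨a, by omega⟩ / ∑ l, s l) * s k := by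
        intro k
        have hk := k.isLt
        simp only [scomp, Fin.val_castAdd, Fin.val_natAdd]
        rw [dif_neg (by omega), dif_pos (by omega)]
        congr 2
        ext
        simp
      rw [Finset.sum_congr rfl fun k _ => this k, ← Finset.mul_sum, div_mul_cancel₀ _ hs]
      simp
      rfl
  · refine Finset.sum_congr rfl fun k _ => ?_
    have hk := k.isLt
    simp only [scomp, Fin.val_natAdd]
    rw [dif_neg (by omega), dif_neg (by omega)]
    congr 1
    ext
    simp
    omega

/-- Sequential associativity of the scaling-operad compositions: for
tuples of positive reals, `(r ∘ᵢ s) ∘_{i+j−1} t = r ∘ᵢ (s ∘ⱼ t)` as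
`(n+m+l−2)`-tuples of positive reals. -/
theorem scomp_sequential_assoc {n m l : ℕ} (hn : 1 ≤ n) (hm : 1 ≤ m) (hl : 1 ≤ l)
    (r : Fin n → ℝ) (s : Fin m → ℝ) (t : Fin l → ℝ)
    (hr : ∀ k, 0 < r k) (hs : ∀ k, 0 < s k) (ht : ∀ k, 0 < t k)
    {i j : ℕ} (hi1 : 1 ≤ i) (hin : i ≤ n) (hj1 : 1 ≤ j) (hjm : j ≤ m) :
    scomp (i + j - 1) (by omega) (by omega) hl
        (show n + m + l - 2 + 1 = (n + m - 1) + l by omega)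
        (scomp i hi1 hin hm (show n + m - 1 + 1 = n + m by omega) r s) t
      = scomp i hi1 hin (by omega)
        (show n + m + l - 2 + 1 = n + (m + l - 1) by omega)
        r (scomp j hj1 hjm hl (show m + l - 1 + 1 = m + l by omega) s t) := by
  have hS : ∑ k, s k ≠ 0 :=
    (Finset.sum_pos (fun k _ => hs k) ⟨⟨0, hm⟩, Finset.mem_univ _⟩).ne'
  have hT : ∑ k, t k ≠ 0 :=
    (Finset.sum_pos (fun k _ => ht k) ⟨⟨0, hl⟩, Finset.mem_univ _⟩).ne'
  have key := scomp_sum j hj1 hjm hl (show m + l - 1 + 1 = m + l by omega) s t hT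
  have er : ∀ (a b : ℕ) (ha : a < n) (hb : b < n), a = b → r ⟨a, ha⟩ = r ⟨b, hb⟩ := by
    intro a b ha hb h; subst h; rfl
  have es : ∀ (a b : ℕ) (ha : a < m) (hb : b < m), a = b → s ⟨a, ha⟩ = s ⟨b, hb⟩ := by
    intro a b ha hb h; subst h; rfl
  have et : ∀ (a b : ℕ) (ha : a < l) (hb : b < l), a = b → t ⟨a, ha⟩ = t ⟨b, hb⟩ := by
    intro a b ha hb h; subst h; rfl
  funext k
  obtain ⟨k, hk⟩ := k
  rw [scomp, scomp.eq_def i hi1 hin (by omega)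
    (show n + m + l - 2 + 1 = n + (m + l - 1) by omega), key]
  simp only [scomp]
  split_ifs <;> first
    | omega
    | rfl
    | (apply er; omega)
    | (congr 1; apply es; omega)
    | (rw [es (i + j - 1 - 1 - (i - 1)) (j - 1) (by omega) (by omega) (by omega),
          et (k - (i + j - 1 - 1)) (k - (i - 1) - (j - 1)) (by omega) (by omega) (by omega)]
       ring)
end
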